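/- Let V ∈ C¹(ℝ³; ℝ) with inf_{q ∈ ℝ³} V(q) > −∞, let ε > 0, and let (r, u) with r ∈ C¹, u ∈ C² be a global solution on [0, ∞) of the effective equation ṙ = u, m(u)u̇ = −∇V(r) + ε a(u)ü + ε b(u, u̇), with sup_{t ≥ 0} |u(t)| ≤ ū < 1 and sup_{t ≥ 0} |u̇(t)| ≤ c. Then ∫₀^∞ [ 6 γ(u(t))⁸ (u(t)·u̇(t))² + γ(u(t))⁶ |u̇(t)|² ] dt < ∞; in particular ∫₀^∞ |u̇(t)|² dt < ∞. -/

import Mathlib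

open Real MeasureTheory Filter
open scoped RealInnerProductSpace

noncomputable section

abbrev E3 : Type := EuclideanSpace ℝ (Fin 3)

/-- relativistic factor γ(v) = (1 - |v|²)^{-1/2} -/
def gam (v : E3) : ℝ := (Real.sqrt (1 - ‖v‖ ^ 2))⁻¹

/-- the function appearing in the square brackets of the soliton momentum -/
def phiFun (s : ℝ) : ℝ :=
  if s = 0 then 1 / 3
  else 1 / (2 * s ^ 2 * (1 - s ^ 2)) - (1 / (4 * s ^ 3)) * Real.log ((1 + s) / (1 - s))

/-- m₀(v)w = γ w + γ³ (v·w) v -/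
def m0Vec (v w : E3) : E3 := gam v • w + (gam v ^ 3 * ⟪v, w⟫) • v

/-- m_f(v)w = 3 mₑ (φ(|v|) w + |v|⁻¹ φ'(|v|)(v·w) v), equal to mₑ • w at v = 0 -/
def mfVec (me : ℝ) (v w : E3) : E3 :=
  (3 * me * phiFun ‖v‖) • w + (3 * me * ‖v‖⁻¹ * deriv phiFun ‖v‖ * ⟪v, w⟫) • v

/-- m(v) = m₀(v) + m_f(v) -/
def mVec (me : ℝ) (v w : E3) : E3 := m0Vec v w + mfVec me v w

/-- a(v)w = (e²/12π)[γ⁴ w + 4 γ⁶ (v·w) v] -/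
def aVec (e : ℝ) (v w : E3) : E3 :=
  (e ^ 2 / (12 * π)) • (gam v ^ 4 • w + (4 * gam v ^ 6 * ⟪v, w⟫) • v)

/-- b(v,w) = (e²/4π)[2γ⁶(v·w)w + γ⁶|w|²v + 6γ⁸(v·w)²v] -/
def bVec (e : ℝ) (v w : E3) : E3 :=
  (e ^ 2 / (4 * π)) •
    ((2 * gam v ^ 6 * ⟪v, w⟫) • w + (gam v ^ 6 * ‖w‖ ^ 2) • v
      + (6 * gam v ^ 8 * ⟪v, w⟫ ^ 2) • v)

/-- soliton energy ℰ_s(v), extended by ℰ_s(0) = 0 -/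
def Es (me : ℝ) (v : E3) : ℝ :=
  if ‖v‖ = 0 then 0
  else gam v - 1 + 3 * me * ((2 - ‖v‖ ^ 2) / (2 * (1 - ‖v‖ ^ 2))
    - (1 / (2 * ‖v‖)) * Real.log ((1 + ‖v‖) / (1 - ‖v‖)))

/-- the field part of the soliton energy per unit of `3 mₑ`, as a function of the speed -/
def fieldEnergy (s : ℝ) : ℝ :=
  if s = 0 then 0
  else (2 - s ^ 2) / (2 * (1 - s ^ 2)) - (1 / (2 * s)) * Real.log ((1 + s) / (1 - s))

theorem log_ratio_bounds {s : ℝ} (h0 : 0 ≤ s) (h1 : s < 1) :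
    2 * s ≤ Real.log ((1 + s) / (1 - s)) ∧
      Real.log ((1 + s) / (1 - s)) ≤ 2 * s * (1 - s ^ 2)⁻¹ := by
  rw [Real.log_div (by linarith) (by linarith)]
  have hs := Real.hasSum_log_sub_log_of_abs_lt_one (abs_lt.2 ⟨by linarith, h1⟩)
  have hg := (hasSum_geometric_of_lt_one (sq_nonneg s) (by nlinarith)).mul_left (2 * s)
  constructor
  · simpa using le_hasSum hs 0 (fun k _ => by positivity)
  · refine hasSum_le (fun k => ?_) hs hg
    have hk : (1 : ℝ) / (2 * k + 1) ≤ 1 := by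
      rw [div_le_one (by positivity)]
      linarith [(Nat.cast_nonneg k : (0 : ℝ) ≤ k)]
    have hp : 2 * s * (s ^ 2) ^ k = 2 * 1 * s ^ (2 * k + 1) := by ring
    rw [hp]
    gcongr

theorem abs_fieldEnergy_le {s : ℝ} (h0 : 0 ≤ s) (h1 : s < 1) :
    |fieldEnergy s| ≤ s ^ 2 / (1 - s ^ 2) := by
  have hd : 0 < 1 - s ^ 2 := by nlinarith
  unfold fieldEnergy
  split_ifs with hs
  · simp [hs]
  have hpos : 0 < s := lt_of_le_of_ne h0 (Ne.symm hs)
  obtain ⟨hl, hu⟩ := log_ratio_bounds h0 h1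
  set L := Real.log ((1 + s) / (1 - s))
  have e1 : (2 - s ^ 2) / (2 * (1 - s ^ 2)) = 1 + s ^ 2 / (1 - s ^ 2) / 2 := by
    field_simp
    ring
  have e2 : (1 - s ^ 2)⁻¹ = 1 + s ^ 2 / (1 - s ^ 2) := by
    field_simp
    ring
  have hq : 0 ≤ s ^ 2 / (1 - s ^ 2) := by positivity
  have l1 : 1 ≤ 1 / (2 * s) * L := by
    rw [one_div, ← div_eq_inv_mul, le_div_iff₀ (by positivity)]
    linarith
  have l2 : 1 / (2 * s) * L ≤ 1 + s ^ 2 / (1 - s ^ 2) := by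
    rw [← e2, one_div, ← div_eq_inv_mul, div_le_iff₀ (by positivity)]
    linarith
  rw [e1, abs_le]
  constructor <;> linarith

theorem hasDerivAt_log_ratio {s : ℝ} (h0 : 0 < s) (h1 : s < 1) :
    HasDerivAt (fun x : ℝ => Real.log ((1 + x) / (1 - x))) (2 / (1 - s ^ 2)) s := by
  have hd : 1 - s ≠ 0 := by linarith
  have hd' : 1 + s ≠ 0 := by linarith
  have h := (((hasDerivAt_id' s).const_add 1).div ((hasDerivAt_id' s).const_sub 1) hd).log
    (div_ne_zero hd' hd)
  refine HasDerivAt.congr_deriv h ?_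
  simp only [Pi.div_apply]
  have : 1 - s ^ 2 = (1 - s) * (1 + s) := by ring
  rw [this]
  field_simp
  ring

theorem hasDerivAt_phiFun {s : ℝ} (h0 : 0 < s) (h1 : s < 1) :
    HasDerivAt phiFun
      (-(1 - 2 * s ^ 2) / (s ^ 3 * (1 - s ^ 2) ^ 2)
        + 3 * Real.log ((1 + s) / (1 - s)) / (4 * s ^ 4) - 1 / (2 * s ^ 3 * (1 - s ^ 2))) s := by
  have hd : 1 - s ^ 2 ≠ 0 := by nlinarith
  have hs := h0.ne'
  have hA := (((hasDerivAt_pow 2 s).const_mul 2).mul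
    ((hasDerivAt_pow 2 s).const_sub 1)).inv (mul_ne_zero (by positivity) hd)
  have hB := ((hasDerivAt_pow 3 s).const_mul 4).inv (by positivity)
  have h := hA.sub (hB.mul (hasDerivAt_log_ratio h0 h1))
  have hev : phiFun =ᶠ[nhds s] fun x =>
      (2 * x ^ 2 * (1 - x ^ 2))⁻¹ - (4 * x ^ 3)⁻¹ * Real.log ((1 + x) / (1 - x)) := by
    filter_upwards [lt_mem_nhds h0] with x hx
    simp [phiFun, hx.ne']
  refine HasDerivAt.congr_of_eventuallyEq (HasDerivAt.congr_deriv h ?_) hev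
  simp only [Pi.mul_apply, Pi.inv_apply]
  push_cast
  field_simp
  ring

theorem hasDerivAt_fieldEnergy {s : ℝ} (h0 : 0 < s) (h1 : s < 1) :
    HasDerivAt fieldEnergy (s * (phiFun s + s * deriv phiFun s)) s := by
  have hd : 1 - s ^ 2 ≠ 0 := by nlinarith
  have hs := h0.ne'
  have hA := ((hasDerivAt_pow 2 s).const_sub 2).div
    (((hasDerivAt_pow 2 s).const_sub 1).const_mul 2) (mul_ne_zero two_ne_zero hd)
  have hB := ((hasDerivAt_id' s).const_mul 2).inv (by positivity)
  have h := hA.sub (hB.mul (hasDerivAt_log_ratio h0 h1))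
  have hev : fieldEnergy =ᶠ[nhds s] fun x =>
      (2 - x ^ 2) / (2 * (1 - x ^ 2)) - (2 * x)⁻¹ * Real.log ((1 + x) / (1 - x)) := by
    filter_upwards [lt_mem_nhds h0] with x hx
    simp [fieldEnergy, hx.ne']
  refine HasDerivAt.congr_of_eventuallyEq (HasDerivAt.congr_deriv h ?_) hev
  rw [(hasDerivAt_phiFun h0 h1).deriv]
  simp only [phiFun, if_neg hs, Pi.inv_apply]
  push_cast
  field_simp
  ring

theorem hasFDerivAt_fieldEnergy_norm_zero :
    HasFDerivAt (fun v : E3 => fieldEnergy ‖v‖) (0 : E3 →L[ℝ] ℝ) 0 := by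
  refine Asymptotics.IsBigO.hasFDerivAt (n := 2) ?_ one_lt_two
  refine Asymptotics.IsBigO.of_bound 2 ?_
  filter_upwards [Metric.ball_mem_nhds (0 : E3) (show (0 : ℝ) < 1 / 2 by norm_num)] with v hv
  have hv' : ‖v‖ < 1 / 2 := by simpa using hv
  have hn := norm_nonneg v
  have hsq : ‖v‖ ^ 2 ≤ 1 / 2 := by nlinarith
  rw [Real.norm_eq_abs, sub_zero, norm_pow, norm_norm]
  refine (abs_fieldEnergy_le hn (by linarith)).trans ?_
  rw [div_le_iff₀ (by linarith)]
  nlinarith [sq_nonneg ‖v‖]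

theorem gam_pos {v : E3} (hv : ‖v‖ < 1) : 0 < gam v :=
  inv_pos.2 (Real.sqrt_pos.2 (by nlinarith [norm_nonneg v]))

theorem gam_sq_mul {v : E3} (hv : ‖v‖ < 1) : gam v ^ 2 * (1 - ‖v‖ ^ 2) = 1 := by
  have h : 0 < 1 - ‖v‖ ^ 2 := by nlinarith [norm_nonneg v]
  rw [gam, inv_pow, Real.sq_sqrt h.le, inv_mul_cancel₀ h.ne']

theorem one_le_gam {v : E3} (hv : ‖v‖ < 1) : 1 ≤ gam v := by
  nlinarith [gam_pos hv, gam_sq_mul hv, mul_nonneg (sq_nonneg (gam v)) (sq_nonneg ‖v‖)]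

theorem gam_le {v : E3} {b : ℝ} (hv : ‖v‖ ≤ b) (hb : b < 1) :
    gam v ≤ (Real.sqrt (1 - b ^ 2))⁻¹ := by
  have h0 := norm_nonneg v
  have h : 0 < 1 - b ^ 2 := by nlinarith
  unfold gam
  gcongr

section Curve

variable {u : ℝ → E3} {w : E3} {S : Set ℝ} {t : ℝ}

theorem hasDerivWithinAt_gam_comp (hu : HasDerivWithinAt u w S t) (h1 : ‖u t‖ < 1) :
    HasDerivWithinAt (fun x => gam (u x)) (gam (u t) ^ 3 * ⟪u t, w⟫) S t := by
  have hp : 0 < 1 - ‖u t‖ ^ 2 := by nlinarith [norm_nonneg (u t)]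
  have h := ((hu.norm_sq.const_sub 1).sqrt hp.ne').inv (Real.sqrt_pos.2 hp).ne'
  refine HasDerivWithinAt.congr_deriv h ?_
  unfold gam
  have := (Real.sqrt_pos.2 hp).ne'
  field_simp

theorem hasDerivWithinAt_fieldEnergy_comp (hu : HasDerivWithinAt u w S t) (h1 : ‖u t‖ < 1) :
    HasDerivWithinAt (fun x => fieldEnergy ‖u x‖)
      ((phiFun ‖u t‖ + ‖u t‖ * deriv phiFun ‖u t‖) * ⟪u t, w⟫) S t := by
  by_cases h0 : u t = 0
  · have h := (h0 ▸ hasFDerivAt_fieldEnergy_norm_zero :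
      HasFDerivAt (fun v : E3 => fieldEnergy ‖v‖) (0 : E3 →L[ℝ] ℝ) (u t)).comp_hasDerivWithinAt
        t hu
    refine HasDerivWithinAt.congr_deriv h ?_
    simp [h0]
  · have hpos : 0 < ‖u t‖ := norm_pos_iff.2 h0
    have hn : HasDerivWithinAt (fun x => ‖u x‖) (⟪u t, w⟫ / ‖u t‖) S t := by
      have h := hu.norm_sq.sqrt (pow_ne_zero 2 hpos.ne')
      simp only [Real.sqrt_sq (norm_nonneg _)] at h
      refine HasDerivWithinAt.congr_deriv h ?_
      field_simp
    have h := (hasDerivAt_fieldEnergy hpos h1).comp_hasDerivWithinAt t hn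
    refine HasDerivWithinAt.congr_deriv h ?_
    field_simp

theorem hasDerivWithinAt_comp_gradient {V : E3 → ℝ} (hV : ContDiff ℝ 1 V)
    (hu : HasDerivWithinAt u w S t) :
    HasDerivWithinAt (fun x => V (u x)) ⟪gradient V (u t), w⟫ S t := by
  have h := ((hV.differentiable one_ne_zero) (u t)).hasGradientAt.hasFDerivAt
  refine HasDerivWithinAt.congr_deriv (h.comp_hasDerivWithinAt t hu) ?_
  exact InnerProductSpace.toDual_apply_apply

end Curve

theorem inner_mVec {v w : E3} (me : ℝ) (hv : ‖v‖ < 1) :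
    ⟪v, mVec me v w⟫ = gam v ^ 3 * ⟪v, w⟫
      + 3 * me * ((phiFun ‖v‖ + ‖v‖ * deriv phiFun ‖v‖) * ⟪v, w⟫) := by
  have hg := gam_sq_mul hv
  have hn : ‖v‖⁻¹ * ‖v‖ ^ 2 = ‖v‖ := by
    rcases eq_or_ne ‖v‖ 0 with h | h
    · simp [h]
    · field_simp
  simp only [mVec, m0Vec, mfVec, inner_add_right, real_inner_smul_right,
    real_inner_self_eq_norm_sq]
  linear_combination (-gam v * ⟪v, w⟫) * hg + 3 * me * deriv phiFun ‖v‖ * ⟪v, w⟫ * hn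

theorem inner_aVec_add_bVec {v w z : E3} (e : ℝ) (hv : ‖v‖ < 1) :
    ⟪v, aVec e v z⟫ + ⟪v, bVec e v w⟫ = e ^ 2 / (12 * π) *
      ((24 * gam v ^ 8 - 12 * gam v ^ 6) * ⟪v, w⟫ ^ 2
        + (4 * gam v ^ 6 - 3 * gam v ^ 4) * (‖w‖ ^ 2 + ⟪v, z⟫)
        - (6 * gam v ^ 8 * ⟪v, w⟫ ^ 2 + gam v ^ 6 * ‖w‖ ^ 2)) := by
  have hg := gam_sq_mul hv
  have hk : e ^ 2 / (4 * π) = 3 * (e ^ 2 / (12 * π)) := by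
    field_simp
    ring
  simp only [aVec, bVec, inner_add_right, real_inner_smul_right, real_inner_self_eq_norm_sq, hk]
  linear_combination (-(e ^ 2 / (12 * π)) * (4 * gam v ^ 4 * ⟪v, z⟫ + 3 * gam v ^ 4 * ‖w‖ ^ 2
    + 18 * gam v ^ 6 * ⟪v, w⟫ ^ 2)) * hg

theorem integrableOn_of_hasDerivWithinAt_neg_mul {H g : ℝ → ℝ} {k B : ℝ} (hk : 0 < k)
    (hH : ∀ t ∈ Set.Ici (0 : ℝ), HasDerivWithinAt H (-k * g t) (Set.Ici 0) t)
    (hg : ∀ t ∈ Set.Ici (0 : ℝ), 0 ≤ g t) (hB : ∀ t ∈ Set.Ici (0 : ℝ), B ≤ H t) :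
    IntegrableOn g (Set.Ici 0) := by
  have hder : ∀ t ∈ Set.Ioi (0 : ℝ), HasDerivAt H (-k * g t) t := fun t ht =>
    (hH t (Set.mem_Ici.2 (le_of_lt ht))).hasDerivAt (Ici_mem_nhds ht)
  have hnp : ∀ t ∈ Set.Ici (0 : ℝ), -k * g t ≤ 0 := fun t ht => by
    nlinarith [hg t ht]
  have hanti : AntitoneOn H (Set.Ici 0) := by
    refine antitoneOn_of_deriv_nonpos (convex_Ici 0)
      (fun t ht => (hH t ht).continuousWithinAt) ?_ ?_ <;> rw [interior_Ici]
    · exact fun t ht => (hder t ht).differentiableAt.differentiableWithinAt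
    · intro t ht
      rw [(hder t ht).deriv]
      exact hnp t (Set.mem_Ici.2 (le_of_lt ht))
  have hanti' : Antitone fun t => H (max t 0) := fun x y hxy =>
    hanti (Set.mem_Ici.2 (le_max_right _ _)) (Set.mem_Ici.2 (le_max_right _ _))
      (max_le_max_right 0 hxy)
  have hlim := tendsto_atTop_ciInf hanti' ⟨B, by
    rintro _ ⟨t, rfl⟩
    exact hB _ (Set.mem_Ici.2 (le_max_right _ _))⟩
  have hlim' := hlim.congr' (f₂ := H) (by
    filter_upwards [eventually_ge_atTop 0] with t ht
    rw [max_eq_left ht])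
  have hint := integrableOn_Ioi_deriv_of_nonpos (hH 0 Set.self_mem_Ici).continuousWithinAt hder
    (fun t ht => hnp t (Set.mem_Ici.2 (le_of_lt ht))) hlim'
  rw [integrableOn_Ici_iff_integrableOn_Ioi]
  refine (Integrable.const_mul hint (-k)⁻¹).congr (Eventually.of_forall fun t => ?_)
  have : -k ≠ 0 := by linarith
  field_simp

/-- for V ∈ C¹ bounded below, any global solution of the effective equation
on [0,∞) with sup|u| ≤ ū < 1 and sup|u̇| ≤ c satisfies
∫₀^∞ [6γ(u)⁸(u·u̇)² + γ(u)⁶|u̇|²] dt < ∞; in particular ∫₀^∞ |u̇|² dt < ∞. -/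
theorem dissipation_integrable
    (e me ε : ℝ) (he : e ≠ 0) (hme : 0 ≤ me) (hε : 0 < ε)
    (V : E3 → ℝ) (hV : ContDiff ℝ 1 V)
    (hVbelow : BddBelow (Set.range V))
    (r u u' u'' : ℝ → E3)
    (hr : ∀ t ∈ Set.Ici (0 : ℝ), HasDerivWithinAt r (u t) (Set.Ici 0) t)
    (hu : ∀ t ∈ Set.Ici (0 : ℝ), HasDerivWithinAt u (u' t) (Set.Ici 0) t)
    (hu' : ∀ t ∈ Set.Ici (0 : ℝ), HasDerivWithinAt u' (u'' t) (Set.Ici 0) t)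
    (heq : ∀ t ∈ Set.Ici (0 : ℝ),
      mVec me (u t) (u' t)
        = -gradient V (r t) + ε • aVec e (u t) (u'' t) + ε • bVec e (u t) (u' t))
    (ubar c : ℝ) (hubar : ubar < 1)
    (hu_bd : ∀ t ∈ Set.Ici (0 : ℝ), ‖u t‖ ≤ ubar)
    (hu'_bd : ∀ t ∈ Set.Ici (0 : ℝ), ‖u' t‖ ≤ c) :
    IntegrableOn
      (fun t => 6 * gam (u t) ^ 8 * ⟪u t, u' t⟫ ^ 2 + gam (u t) ^ 6 * ‖u' t‖ ^ 2)
      (Set.Ici 0)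
    ∧ IntegrableOn (fun t => ‖u' t‖ ^ 2) (Set.Ici 0) := by
  have hlt : ∀ t ∈ Set.Ici (0 : ℝ), ‖u t‖ < 1 := fun t ht => (hu_bd t ht).trans_lt hubar
  set K : ℝ := e ^ 2 / (12 * π) with hK
  have hKpos : 0 < K := by positivity
  set H : ℝ → ℝ := fun t => gam (u t) + 3 * me * fieldEnergy ‖u t‖ + V (r t)
    - ε * K * ((4 * gam (u t) ^ 6 - 3 * gam (u t) ^ 4) * ⟪u t, u' t⟫) with hHdef
  have hH : ∀ t ∈ Set.Ici (0 : ℝ), HasDerivWithinAt H (-(ε * K) *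
      (6 * gam (u t) ^ 8 * ⟪u t, u' t⟫ ^ 2 + gam (u t) ^ 6 * ‖u' t‖ ^ 2)) (Set.Ici 0) t := by
    intro t ht
    have h1 := hlt t ht
    have hγ := hasDerivWithinAt_gam_comp (hu t ht) h1
    have hp := (hu t ht).inner ℝ (hu' t ht)
    have h := ((hγ.add ((hasDerivWithinAt_fieldEnergy_comp (hu t ht) h1).const_mul (3 * me))).add
      (hasDerivWithinAt_comp_gradient hV (hr t ht))).sub
        (((((hγ.pow 6).const_mul 4).sub ((hγ.pow 4).const_mul 3)).mul hp).const_mul (ε * K))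
    refine HasDerivWithinAt.congr_deriv h ?_
    have hE := congrArg (fun x => ⟪u t, x⟫) (heq t ht)
    simp only [inner_add_right, inner_neg_right, real_inner_smul_right] at hE
    rw [inner_mVec me h1, real_inner_comm (gradient V (r t)) (u t)] at hE
    have hab := inner_aVec_add_bVec (w := u' t) (z := u'' t) e h1
    rw [← hK] at hab
    simp only [real_inner_self_eq_norm_sq, Pi.pow_apply, Pi.sub_apply]
    push_cast
    linear_combination hE + ε * hab
  obtain ⟨b, hb⟩ := hVbelow
  set Γ : ℝ := (Real.sqrt (1 - ubar ^ 2))⁻¹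
  have hubar0 : 0 ≤ ubar := (norm_nonneg _).trans (hu_bd 0 Set.self_mem_Ici)
  have hbelow : ∀ t ∈ Set.Ici (0 : ℝ),
      -(3 * me * (ubar ^ 2 / (1 - ubar ^ 2))) + b - ε * K * (4 * Γ ^ 6 * c) ≤ H t := by
    intro t ht
    have h1 := hlt t ht
    have hn := norm_nonneg (u t)
    have hγ1 := one_le_gam h1
    have hγΓ : gam (u t) ≤ Γ := gam_le (hu_bd t ht) hubar
    have hV' : b ≤ V (r t) := hb ⟨r t, rfl⟩
    have hd : 0 < 1 - ubar ^ 2 := by nlinarith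
    have hF : -(ubar ^ 2 / (1 - ubar ^ 2)) ≤ fieldEnergy ‖u t‖ := by
      have h2 : ‖u t‖ ^ 2 / (1 - ‖u t‖ ^ 2) ≤ ubar ^ 2 / (1 - ubar ^ 2) := by
        gcongr <;> exact hu_bd t ht
      linarith [(abs_le.1 (abs_fieldEnergy_le hn h1)).1]
    have hF' := mul_le_mul_of_nonneg_left hF (show 0 ≤ 3 * me by positivity)
    have hp : |⟪u t, u' t⟫| ≤ c := by
      refine (abs_real_inner_le_norm _ _).trans ?_
      nlinarith [hu'_bd t ht, norm_nonneg (u' t)]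
    have hcoef : 0 ≤ 4 * gam (u t) ^ 6 - 3 * gam (u t) ^ 4 := by
      have := pow_le_pow_right₀ hγ1 (show 4 ≤ 6 by norm_num)
      have : 0 ≤ gam (u t) ^ 6 := by positivity
      linarith
    have hcoef' : 4 * gam (u t) ^ 6 - 3 * gam (u t) ^ 4 ≤ 4 * Γ ^ 6 := by
      have : gam (u t) ^ 6 ≤ Γ ^ 6 := by gcongr
      have : 0 ≤ gam (u t) ^ 4 := by positivity
      linarith
    have hS : (4 * gam (u t) ^ 6 - 3 * gam (u t) ^ 4) * ⟪u t, u' t⟫ ≤ 4 * Γ ^ 6 * c :=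
      (mul_le_mul_of_nonneg_left ((le_abs_self _).trans hp) hcoef).trans
        (mul_le_mul_of_nonneg_right hcoef' ((abs_nonneg _).trans hp))
    have hS' := mul_le_mul_of_nonneg_left hS (show 0 ≤ ε * K by positivity)
    simp only [hHdef]
    linarith
  have hmain : IntegrableOn
      (fun t => 6 * gam (u t) ^ 8 * ⟪u t, u' t⟫ ^ 2 + gam (u t) ^ 6 * ‖u' t‖ ^ 2)
      (Set.Ici 0) := by
    refine integrableOn_of_hasDerivWithinAt_neg_mul (mul_pos hε hKpos) hH (fun t ht => ?_) hbelow
    have := gam_pos (hlt t ht)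
    positivity
  refine ⟨hmain, Integrable.mono' hmain ?_ ?_⟩
  · have hc : ContinuousOn u' (Set.Ici 0) := fun t ht => (hu' t ht).continuousWithinAt
    exact (hc.norm.pow 2).aestronglyMeasurable measurableSet_Ici
  · refine (ae_restrict_mem measurableSet_Ici).mono fun t ht => ?_
    have hγ := one_le_gam (hlt t ht)
    have h6 : 1 ≤ gam (u t) ^ 6 := one_le_pow₀ hγ
    have h8 : 0 ≤ 6 * gam (u t) ^ 8 * ⟪u t, u' t⟫ ^ 2 := by positivity
    rw [Real.norm_eq_abs, abs_of_nonneg (sq_nonneg _)]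
    nlinarith [sq_nonneg ‖u' t‖]
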